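/- Let ν > 0 and let h : ℝ → ℝ be continuously differentiable with both h and h' Lipschitz-continuous. Then there exists a continuously differentiable solution f_h on ℝ of the centered Gamma Stein equation 2(x+ν) f'(x) − x f(x) = h(x) − E[h(Z_ν)] whose derivative f_h' is Lipschitz-continuous with minimum Lipschitz constant ‖f_h''‖ ≤ max(1, 2/ν)·‖h'‖ + ‖h''‖. -/

import Mathlib

open MeasureTheory ProbabilityTheory Real

/-- The minimum Lipschitz constant `‖g'‖ = sup_{x ≠ y} |g x - g y| / |x - y|` of `g : ℝ → ℝ`. -/
noncomputable def lipConst (g : ℝ → ℝ) : ℝ :=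
  sSup {c | ∃ x y : ℝ, x ≠ y ∧ c = |g x - g y| / |x - y|}

/-- The expectation `E[h(Z_ν)]` of `h` under the centered Gamma distribution `Γ̄(ν)`, the law of
`Z_ν = 2 X_{ν/2,1} − ν` where `X_{ν/2,1} ∼ Γ(ν/2, 1)`. -/
noncomputable def centeredGammaExp (ν : ℝ) (h : ℝ → ℝ) : ℝ :=
  ∫ x, h (2 * x - ν) ∂(gammaMeasure (ν / 2) 1)


open Set Filter Topology

/-- auxiliary integral operator -/
noncomputable def gS (c m : ℝ) (q : ℝ → ℝ) (t : ℝ) : ℝ :=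
  ∫ r in (0:ℝ)..1, (1/2) * r ^ (m/2-1) * (exp (c * t * (1 - r)) * q (t * r))

lemma gS_intble (m : ℝ) (hm : 0 < m) (w : ℝ → ℝ) (hw : Continuous w) (a b : ℝ) :
    IntervalIntegrable (fun r : ℝ => (1/2) * r ^ (m/2-1) * w r) volume a b := by
  have h1 : IntervalIntegrable (fun r : ℝ => r ^ (m/2-1)) volume a b :=
    intervalIntegral.intervalIntegrable_rpow' (by linarith)
  exact (h1.const_mul (1/2)).mul_continuousOn hw.continuousOn

lemma gS_cont (c m : ℝ) (hm : 0 < m) (q : ℝ → ℝ) (hq : Continuous q) :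
    Continuous (gS c m q) := by
  rw [continuous_iff_continuousAt]
  intro t0
  unfold gS
  have hc : Continuous (fun p : ℝ × ℝ => exp (c * p.1 * (1 - p.2)) * q (p.1 * p.2)) := by fun_prop
  obtain ⟨M, hM⟩ := ((isCompact_closedBall t0 1).prod (isCompact_Icc (a := (0:ℝ)) (b := 1))).exists_bound_of_continuousOn hc.continuousOn
  apply intervalIntegral.continuousAt_of_dominated_interval
    (bound := fun r => (1/2) * r ^ (m/2-1) * M)
  · refine Eventually.of_forall fun t => ?_
    have := (gS_intble m hm (fun r => exp (c * t * (1 - r)) * q (t * r)) (by fun_prop) 0 1).aestronglyMeasurable_restrict_uIoc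
    exact this
  · filter_upwards [Metric.closedBall_mem_nhds t0 one_pos] with t ht
    refine Eventually.of_forall fun r hr => ?_
    rw [uIoc_of_le zero_le_one] at hr
    have h1 := hM (t, r) ⟨ht, ⟨hr.1.le, hr.2⟩⟩
    rw [norm_mul, Real.norm_of_nonneg (by have := rpow_nonneg hr.1.le (m/2-1); positivity)]
    have := rpow_nonneg hr.1.le (m/2-1)
    gcongr
  · exact gS_intble m hm (fun _ => M) continuous_const 0 1
  · refine Eventually.of_forall fun r hr => ?_
    apply Continuous.continuousAt
    fun_prop

lemma gS_subst (c m : ℝ) (q : ℝ → ℝ) {t : ℝ} (ht : 0 < t) :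
    (∫ s in (0:ℝ)..t, s ^ (m/2-1) * (exp (-c * s) * q s)) =
      2 * t ^ (m/2) * exp (-c * t) * gS c m q t := by
  have h1 := intervalIntegral.smul_integral_comp_mul_left (a := 0) (b := 1)
    (fun s => s ^ (m/2-1) * (exp (-c * s) * q s)) t
  simp only [mul_zero, mul_one] at h1
  rw [← h1, gS, smul_eq_mul, ← intervalIntegral.integral_const_mul, ← intervalIntegral.integral_const_mul]
  apply intervalIntegral.integral_congr
  intro r hr
  rw [uIcc_of_le zero_le_one] at hr
  simp only
  rw [mul_rpow ht.le hr.1, rpow_sub_one ht.ne']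
  have : exp (-c * (t * r)) = exp (-c * t) * exp (c * t * (1 - r)) := by
    rw [← exp_add]; ring_nf
  rw [this]
  field_simp

lemma gS_deriv_pos (c m : ℝ) (hm : 0 < m) (q : ℝ → ℝ) (hq : Continuous q) {t : ℝ} (ht : 0 < t) :
    HasDerivAt (gS c m q) ((q t + (2 * c * t - m) * gS c m q t) / (2 * t)) t := by
  have e : gS c m q =ᶠ[𝓝 t] fun t => (1/2) * t ^ (-(m/2)) * exp (c * t) *
      ∫ s in (0:ℝ)..t, s ^ (m/2-1) * (exp (-c * s) * q s) := by
    filter_upwards [lt_mem_nhds ht] with x hx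
    rw [gS_subst c m q hx, rpow_neg hx.le]
    have : exp (-c * x) = (exp (c * x))⁻¹ := by rw [← exp_neg]; ring_nf
    rw [this]
    have := (rpow_pos_of_pos hx (m/2)).ne'
    have := (exp_pos (c*x)).ne'
    field_simp
  have hint : IntervalIntegrable (fun s : ℝ => s ^ (m/2-1) * (exp (-c * s) * q s)) volume 0 t :=
    (intervalIntegral.intervalIntegrable_rpow' (by linarith)).mul_continuousOn (by fun_prop)
  have hcon : ∀ s > 0, ContinuousAt (fun s : ℝ => s ^ (m/2-1) * (exp (-c * s) * q s)) s := by
    intro s hs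
    refine (continuousAt_id.rpow_const (Or.inl hs.ne')).mul (Continuous.continuousAt (by fun_prop))
  have d1 := intervalIntegral.integral_hasDerivAt_right hint
    (ContinuousOn.stronglyMeasurableAtFilter (s := Ioi 0) isOpen_Ioi (fun s hs => (hcon s hs).continuousWithinAt) t ht) (hcon t ht)
  have d2 : HasDerivAt (fun t : ℝ => t ^ (-(m/2))) (-(m/2) * t ^ (-(m/2) - 1)) t :=
    Real.hasDerivAt_rpow_const (Or.inl ht.ne')
  have d3 : HasDerivAt (fun t : ℝ => exp (c * t)) (exp (c * t) * (c * 1)) t :=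
    ((hasDerivAt_id t).const_mul c).exp
  have d := (((d2.const_mul (1/2)).mul d3).mul d1).congr_of_eventuallyEq e
  refine d.congr_deriv ?_
  have hI := gS_subst c m q ht
  simp only [Pi.mul_apply]
  rw [hI, rpow_neg ht.le, rpow_sub_one ht.ne', rpow_sub_one ht.ne', rpow_neg ht.le]
  have : exp (-c * t) = (exp (c * t))⁻¹ := by rw [← exp_neg]; ring_nf
  rw [this]
  have := (rpow_pos_of_pos ht (m/2)).ne'
  have := (exp_pos (c*t)).ne'
  field_simp
  ring

lemma gS_deriv (c m : ℝ) (hm : 0 < m) (q : ℝ → ℝ) (hq : Continuous q) {t : ℝ} (ht : t ≠ 0) :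
    HasDerivAt (gS c m q) ((q t + (2 * c * t - m) * gS c m q t) / (2 * t)) t := by
  rcases lt_or_gt_of_ne ht with h | h
  · have e : ∀ t, gS c m q t = gS (-c) m (fun x => q (-x)) (-t) := by
      intro t; simp [gS]
    have d := gS_deriv_pos (-c) m hm (fun x => q (-x)) (by fun_prop) (t := -t) (by linarith)
    have d2 := HasDerivAt.comp t d (hasDerivAt_neg t)
    have e2 : gS c m q = gS (-c) m (fun x => q (-x)) ∘ (fun x => -x) := funext e
    rw [e2]
    refine d2.congr_deriv ?_
    simp only [neg_neg, Function.comp]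
    field_simp
  · exact gS_deriv_pos c m hm q hq h

lemma gS_unique (m : ℝ) (hm : 0 < m) (q : ℝ → ℝ) (hq : Continuous q) (g : ℝ → ℝ) (B : ℝ)
    (hB : ∀ t ≠ 0, |g t| ≤ B)
    (hg : ∀ t ≠ 0, HasDerivAt g ((q t + (t - m) * g t) / (2 * t)) t) {t : ℝ} (ht : t ≠ 0) :
    g t = gS (1/2) m q t := by
  have hm2 : m / 2 ≠ 0 := by positivity
  have hs0 : ∀ s, 0 < s → t * s ≠ 0 := fun s hs => mul_ne_zero ht hs.ne'
  have dd : ∀ s, 0 < s → HasDerivAt (fun s => s ^ (m/2) * exp (1/2 * t * (1 - s)) * g (t * s))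
      ((1/2) * s ^ (m/2-1) * (exp (1/2 * t * (1 - s)) * q (t * s))) s := by
    intro s hs
    have d1 : HasDerivAt (fun s : ℝ => s ^ (m/2)) ((m/2) * s ^ (m/2 - 1)) s :=
      Real.hasDerivAt_rpow_const (Or.inl hs.ne')
    have d2 : HasDerivAt (fun s : ℝ => exp (1/2 * t * (1 - s))) (exp (1/2 * t * (1 - s)) * (1/2 * t * (-1))) s :=
      (((hasDerivAt_id s).const_sub 1).const_mul (1/2 * t)).exp
    have d3 := HasDerivAt.comp s (hg (t * s) (hs0 s hs)) ((hasDerivAt_id s).const_mul t)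
    refine ((d1.mul d2).mul d3).congr_deriv ?_
    simp only [Pi.mul_apply, Function.comp]
    rw [rpow_sub_one hs.ne']
    field_simp
    ring
  have key := intervalIntegral.integral_eq_sub_of_hasDerivAt_of_le (zero_le_one' ℝ)
    (f := fun s => s ^ (m/2) * exp (1/2 * t * (1 - s)) * g (t * s))
    (f' := fun s => (1/2) * s ^ (m/2-1) * (exp (1/2 * t * (1 - s)) * q (t * s))) ?_ (fun s hs => dd s hs.1)
    (gS_intble m hm _ (by fun_prop) 0 1)
  · rw [gS, key]
    simp [zero_rpow hm2]
  · intro s hs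
    rcases hs.1.eq_or_lt with h | h
    · subst h
      have hz : Tendsto (fun s : ℝ => s ^ (m/2) * exp (1/2 * t * (1 - s)) * (|g 0| + B)) (𝓝[Icc 0 1] 0) (𝓝 0) := by
        have : ContinuousAt (fun s : ℝ => s ^ (m/2) * exp (1/2 * t * (1 - s)) * (|g 0| + B)) 0 := by
          refine ((continuousAt_id.rpow_const (Or.inr (by positivity))).mul ?_).mul continuousAt_const
          exact Continuous.continuousAt (by fun_prop)
        have h2 := this.tendsto
        simp only [zero_rpow hm2, zero_mul] at h2
        exact h2.mono_left nhdsWithin_le_nhds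
      rw [ContinuousWithinAt]
      simp only [zero_rpow hm2, zero_mul]
      refine squeeze_zero_norm' ?_ hz
      filter_upwards [self_mem_nhdsWithin] with s hs
      have hp := rpow_nonneg hs.1 (m/2)
      rw [norm_mul, norm_mul, Real.norm_of_nonneg hp, Real.norm_of_nonneg (exp_pos _).le]
      gcongr
      rcases hs.1.eq_or_lt with h | h
      · subst h
        have := (abs_nonneg _).trans (hB 1 one_ne_zero)
        simp; exact this
      · have := hB _ (hs0 s h)
        have := abs_nonneg (g 0)
        rw [Real.norm_eq_abs]; linarith
    · exact (dd s h).continuousAt.continuousWithinAt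

/-- unnormalised Gamma weight -/
noncomputable def gW (m s : ℝ) : ℝ := s ^ (m/2-1) * exp (-(1/2) * s)

lemma gW_pos (m : ℝ) {s : ℝ} (hs : 0 < s) : 0 < gW m s := by
  unfold gW; positivity

lemma gW_mul (m : ℝ) {s : ℝ} (hs : 0 < s) : s * gW m s = gW (m+2) s := by
  unfold gW
  rw [show (m+2)/2-1 = m/2 - 1 + 1 by ring, rpow_add_one hs.ne']
  ring

lemma gW_int (m : ℝ) (hm : 0 < m) : IntegrableOn (gW m) (Ioi 0) := by
  have := integrableOn_rpow_mul_exp_neg_mul_rpow (p := 1) (s := m/2-1) (b := 1/2) (by linarith) one_pos (by norm_num)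
  simp only [rpow_one] at this
  exact this

lemma lip_cont {q : ℝ → ℝ} {L : ℝ} (hL : 0 ≤ L) (hq : ∀ x y, |q x - q y| ≤ L * |x - y|) :
    Continuous q := by
  have : LipschitzWith (Real.toNNReal L) q := by
    apply LipschitzWith.of_dist_le_mul
    intro x y
    rw [Real.coe_toNNReal _ hL, Real.dist_eq, Real.dist_eq]
    exact hq x y
  exact this.continuous

lemma gW_lip_int (m : ℝ) (hm : 0 < m) {q : ℝ → ℝ} {L : ℝ} (hL : 0 ≤ L)
    (hq : ∀ x y, |q x - q y| ≤ L * |x - y|) :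
    IntegrableOn (fun s => q s * gW m s) (Ioi 0) := by
  have h1 : IntegrableOn (fun s => |q 0| * gW m s + L * gW (m+2) s) (Ioi 0) :=
    ((gW_int m hm).const_mul _).add ((gW_int (m+2) (by linarith)).const_mul _)
  refine Integrable.mono' h1 ?_ ?_
  · exact ((lip_cont hL hq).aestronglyMeasurable).mul (gW_int m hm).aestronglyMeasurable
  · refine (ae_restrict_iff' measurableSet_Ioi).mpr (Eventually.of_forall fun s hs => ?_)
    have hs : 0 < s := hs
    have hp := gW_pos m hs
    rw [norm_mul, Real.norm_of_nonneg hp.le, ← gW_mul m hs, Real.norm_eq_abs]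
    have h2 := hq s 0
    rw [sub_zero, abs_of_pos hs] at h2
    have h3 : |q s| ≤ |q 0| + L * s := by
      have := abs_sub_abs_le_abs_sub (q s) (q 0); linarith
    calc |q s| * gW m s ≤ (|q 0| + L * s) * gW m s := by gcongr
      _ = _ := by ring

lemma gW_mean_zero (m : ℝ) (hm : 0 < m) {q g : ℝ → ℝ} {L B : ℝ} (hL : 0 ≤ L)
    (hq : ∀ x y, |q x - q y| ≤ L * |x - y|) (hB : ∀ t, |g t| ≤ B)
    (hg : ∀ t ≠ 0, HasDerivAt g ((q t + (t - m) * g t) / (2 * t)) t) :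
    ∫ s in Ioi 0, q s * gW m s = 0 := by
  have hm2 : m / 2 ≠ 0 := by positivity
  have hb0 : (0:ℝ) ≤ B := (abs_nonneg _).trans (hB 0)
  have dd : ∀ s ∈ Ioi (0:ℝ), HasDerivAt (fun s => 2 * (s ^ (m/2) * exp (-(1/2) * s)) * g s) (q s * gW m s) s := by
    intro s hs
    have hs : 0 < s := hs
    have d1 : HasDerivAt (fun s : ℝ => s ^ (m/2)) ((m/2) * s ^ (m/2 - 1)) s :=
      Real.hasDerivAt_rpow_const (Or.inl hs.ne')
    have d2 : HasDerivAt (fun s : ℝ => exp (-(1/2) * s)) (exp (-(1/2) * s) * (-(1/2) * 1)) s :=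
      ((hasDerivAt_id s).const_mul (-(1/2))).exp
    refine (((d1.mul d2).const_mul 2).mul (hg s hs.ne')).congr_deriv ?_
    simp only [Pi.mul_apply, gW]
    rw [rpow_sub_one hs.ne']
    field_simp
    ring
  have hbd : ∀ s : ℝ, 0 ≤ s → ‖2 * (s ^ (m/2) * exp (-(1/2) * s)) * g s‖ ≤ 2 * (s ^ (m/2) * exp (-(1/2) * s)) * B := by
    intro s hs
    have hp := rpow_nonneg hs (m/2)
    rw [norm_mul, Real.norm_of_nonneg (by positivity)]
    gcongr
    exact hB s
  have key := integral_Ioi_of_hasDerivAt_of_tendsto (a := 0) (m := 0)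
    (f := fun s => 2 * (s ^ (m/2) * exp (-(1/2) * s)) * g s)
    (f' := fun s => q s * gW m s) ?_ dd (gW_lip_int m hm hL hq) ?_
  · rw [key]; simp [zero_rpow hm2]
  · rw [ContinuousWithinAt]
    simp only [zero_rpow hm2, zero_mul, mul_zero]
    have hz : Tendsto (fun s : ℝ => 2 * (s ^ (m/2) * exp (-(1/2) * s)) * B) (𝓝[Ici 0] 0) (𝓝 0) := by
      have : ContinuousAt (fun s : ℝ => 2 * (s ^ (m/2) * exp (-(1/2) * s)) * B) 0 := by
        refine (continuousAt_const.mul ((continuousAt_id.rpow_const (Or.inr (by positivity))).mul ?_)).mul continuousAt_const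
        exact Continuous.continuousAt (by fun_prop)
      have h2 := this.tendsto
      simp only [zero_rpow hm2, zero_mul, mul_zero] at h2
      exact h2.mono_left nhdsWithin_le_nhds
    refine squeeze_zero_norm' ?_ hz
    filter_upwards [self_mem_nhdsWithin] with s hs using hbd s hs
  · have h1 := ((tendsto_rpow_mul_exp_neg_mul_atTop_nhds_zero (m/2) (1/2) (by norm_num)).const_mul 2).mul_const B
    simp only [mul_zero, zero_mul] at h1
    refine squeeze_zero_norm' ?_ h1
    filter_upwards [eventually_ge_atTop 0] with s hs using hbd s hs

lemma gW_mean (m : ℝ) (hm : 0 < m) : ∫ s in Ioi 0, (m - s) * gW m s = 0 := by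
  refine gW_mean_zero m hm (q := fun s => m - s) (g := fun _ => 1) (L := 1) (B := 1) zero_le_one ?_ ?_ ?_
  · intro x y
    rw [one_mul, show m - x - (m - y) = -(x - y) by ring, abs_neg]
  · simp
  · intro t ht
    refine (hasDerivAt_const t (1:ℝ)).congr_deriv ?_
    ring

lemma gS_one (m : ℝ) (hm : 0 < m) {t : ℝ} (ht : t ≠ 0) : gS (1/2) m (fun s => m - s) t = 1 := by
  symm
  refine gS_unique m hm (fun s => m - s) (by fun_prop) (fun _ => 1) 1 (by simp) ?_ ht
  intro t ht
  refine (hasDerivAt_const t (1:ℝ)).congr_deriv ?_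
  ring

lemma gS_gW (m : ℝ) (q : ℝ → ℝ) {t : ℝ} (ht : 0 < t) :
    (∫ s in Ioc 0 t, q s * gW m s) = 2 * t * gW m t * gS (1/2) m q t := by
  have := gS_subst (1/2) m q ht
  rw [intervalIntegral.integral_of_le ht.le] at this
  calc _ = ∫ s in Ioc 0 t, s ^ (m/2-1) * (exp (-(1/2) * s) * q s) := by
        congr 1; ext s; unfold gW; ring
    _ = _ := by
      rw [this, gW, rpow_sub_one ht.ne']; field_simp

lemma bound_pos (m : ℝ) (hm : 0 < m) {q : ℝ → ℝ} {L : ℝ} (hL : 0 ≤ L)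
    (hq : ∀ x y, |q x - q y| ≤ L * |x - y|) (h0 : ∫ s in Ioi 0, q s * gW m s = 0)
    {t : ℝ} (ht : 0 < t) : |q t + (t - m) * gS (1/2) m q t| ≤ 2 * t * L := by
  have sub1 : Ioc 0 t ⊆ Ioi 0 := Ioc_subset_Ioi_self
  have sub2 : Ioi t ⊆ Ioi 0 := Ioi_subset_Ioi ht.le
  have split : ∀ w : ℝ → ℝ, IntegrableOn w (Ioi 0) →
      ∫ s in Ioi 0, w s = (∫ s in Ioc 0 t, w s) + ∫ s in Ioi t, w s := by
    intro w hw
    rw [← setIntegral_union (Ioc_disjoint_Ioi le_rfl) measurableSet_Ioi (hw.mono_set sub1) (hw.mono_set sub2),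
      Ioc_union_Ioi_eq_Ioi ht.le]
  have iW := gW_int m hm
  have iq := gW_lip_int m hm hL hq
  have is : IntegrableOn (fun s => s * gW m s) (Ioi 0) :=
    gW_lip_int m hm (q := fun s => s) (L := 1) zero_le_one (by simp)
  have hsub : ∀ A ⊆ Ioi (0:ℝ), MeasurableSet A → (∫ s in A, (m - s) * gW m s) = m * (∫ s in A, gW m s) - ∫ s in A, s * gW m s := by
    intro A hA _
    rw [← integral_const_mul, ← integral_sub ((iW.mono_set hA).const_mul m) (is.mono_set hA)]
    congr 1; ext s; ring
  have e1 := gS_gW m (fun s => m - s) ht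
  rw [gS_one m hm ht.ne', hsub _ sub1 measurableSet_Ioc] at e1
  have e2 := gW_mean m hm
  rw [hsub _ subset_rfl measurableSet_Ioi, split _ iW, split _ is] at e2
  have e3 := gS_gW m q ht
  rw [split _ iq] at h0
  have hp := gW_pos m ht
  -- nonneg
  have nF : 0 ≤ ∫ s in Ioc 0 t, gW m s :=
    setIntegral_nonneg measurableSet_Ioc fun s hs => (gW_pos m hs.1).le
  have nF' : 0 ≤ ∫ s in Ioi t, gW m s :=
    setIntegral_nonneg measurableSet_Ioi fun s hs => (gW_pos m (ht.trans hs)).le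
  have nS : 0 ≤ ∫ s in Ioc 0 t, s * gW m s :=
    setIntegral_nonneg measurableSet_Ioc fun s hs => mul_nonneg hs.1.le (gW_pos m hs.1).le
  have nZ : 0 < ∫ s in Ioi 0, gW m s := by
    rw [setIntegral_pos_iff_support_of_nonneg_ae _ iW]
    · have : Function.support (gW m) ∩ Ioi 0 = Ioi 0 := by
        apply inter_eq_right.mpr
        intro s hs
        exact (gW_pos m hs).ne'
      rw [this]; simp
    · exact (ae_restrict_iff' measurableSet_Ioi).mpr (Eventually.of_forall fun s hs => (gW_pos m hs).le)
  rw [split _ iW] at nZ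
  have nG' : t * (∫ s in Ioi t, gW m s) ≤ ∫ s in Ioi t, s * gW m s := by
    rw [← integral_const_mul]
    refine setIntegral_mono_on ((iW.mono_set sub2).const_mul t) (is.mono_set sub2) measurableSet_Ioi ?_
    intro s hs
    have := (gW_pos m (ht.trans hs))
    have hs : t < s := hs
    gcongr
  have nG : (∫ s in Ioc 0 t, s * gW m s) ≤ t * (∫ s in Ioc 0 t, gW m s) := by
    rw [← integral_const_mul]
    refine setIntegral_mono_on (is.mono_set sub1) ((iW.mono_set sub1).const_mul t) measurableSet_Ioc ?_
    intro s hs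
    have := (gW_pos m hs.1)
    have := hs.2
    gcongr
  have ba : |q t * (∫ s in Ioc 0 t, gW m s) - ∫ s in Ioc 0 t, q s * gW m s| ≤
      L * (t * (∫ s in Ioc 0 t, gW m s) - ∫ s in Ioc 0 t, s * gW m s) := by
    rw [← integral_const_mul, ← integral_const_mul, ← integral_sub ((iW.mono_set sub1).const_mul _) (iq.mono_set sub1),
      ← integral_sub ((iW.mono_set sub1).const_mul _) (is.mono_set sub1), ← integral_const_mul, ← Real.norm_eq_abs]
    refine norm_integral_le_of_norm_le ((((iW.mono_set sub1).const_mul _).sub (is.mono_set sub1)).const_mul _) ?_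
    refine (ae_restrict_iff' measurableSet_Ioc).mpr (Eventually.of_forall fun s hs => ?_)
    have hw := (gW_pos m hs.1)
    have h := hq t s
    rw [abs_of_nonneg (by linarith [hs.2] : 0 ≤ t - s)] at h
    rw [← sub_mul, norm_mul, Real.norm_of_nonneg hw.le, Real.norm_eq_abs, ← sub_mul, ← mul_assoc]
    gcongr
  have bb : |q t * (∫ s in Ioi t, gW m s) - ∫ s in Ioi t, q s * gW m s| ≤
      L * ((∫ s in Ioi t, s * gW m s) - t * (∫ s in Ioi t, gW m s)) := by
    rw [← integral_const_mul, ← integral_const_mul, ← integral_sub ((iW.mono_set sub2).const_mul _) (iq.mono_set sub2),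
      ← integral_sub (is.mono_set sub2) ((iW.mono_set sub2).const_mul _), ← integral_const_mul, ← Real.norm_eq_abs]
    refine norm_integral_le_of_norm_le (((is.mono_set sub2).sub ((iW.mono_set sub2).const_mul _)).const_mul _) ?_
    refine (ae_restrict_iff' measurableSet_Ioi).mpr (Eventually.of_forall fun s hs => ?_)
    have hs : t < s := hs
    have hw := (gW_pos m (ht.trans hs))
    have h := hq t s
    rw [abs_sub_comm t s, abs_of_nonneg (by linarith : 0 ≤ s - t)] at h
    rw [← sub_mul, norm_mul, Real.norm_of_nonneg hw.le, Real.norm_eq_abs, ← sub_mul, ← mul_assoc]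
    gcongr
  generalize (∫ s in Ioc 0 t, gW m s) = F at *
  generalize (∫ s in Ioi t, gW m s) = F' at *
  generalize (∫ s in Ioc 0 t, s * gW m s) = S at *
  generalize (∫ s in Ioi t, s * gW m s) = S' at *
  generalize (∫ s in Ioc 0 t, q s * gW m s) = Q at *
  generalize (∫ s in Ioi t, q s * gW m s) = Q' at *
  generalize gS (1/2) m q t = u at *
  obtain ⟨pp, hpp⟩ : ∃ pp, pp = 2 * t * gW m t := ⟨_, rfl⟩
  have ppp : 0 < pp := by rw [hpp]; positivity
  rw [← hpp] at e1 e3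
  -- a, b, G, G'
  obtain ⟨a, ha⟩ : ∃ a, a = q t * F - Q := ⟨_, rfl⟩
  obtain ⟨b, hb⟩ : ∃ b, b = q t * F' - Q' := ⟨_, rfl⟩
  obtain ⟨G, hG⟩ : ∃ G, G = t * F - S := ⟨_, rfl⟩
  obtain ⟨G', hG'⟩ : ∃ G', G' = S' - t * F' := ⟨_, rfl⟩
  rw [← ha, ← hG] at ba
  rw [← hb, ← hG'] at bb
  have G0 : 0 ≤ G := by linarith
  have G0' : 0 ≤ G' := by linarith
  have GtF : G ≤ t * F := by linarith
  have f1 : G = (t - m) * F + pp := by linarith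
  have f2 : G' = pp - (t - m) * F' := by linarith
  have main : (F + F') * pp * (q t + (t - m) * u) = a * G' + b * G := by
    have hQ : Q' = - Q := by linarith
    have : pp * u = Q := by linarith
    rw [f1, f2, ha, hb, hQ]
    linear_combination (F + F') * (t - m) * this
  have pid : F * G' + F' * G = pp * (F + F') := by rw [f1, f2]; ring
  have hGG : G * G' ≤ t * (pp * (F + F')) := by
    calc G * G' ≤ t * F * G' := by gcongr
      _ ≤ t * (F * G' + F' * G) := by nlinarith [mul_nonneg ht.le (mul_nonneg nF' G0)]
      _ = _ := by rw [pid]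
  have hpos : 0 < (F + F') * pp := by positivity
  have : (F + F') * pp * |q t + (t - m) * u| ≤ (F + F') * pp * (2 * t * L) := by
    rw [← abs_of_pos hpos, ← abs_mul, abs_of_pos hpos, main]
    calc |a * G' + b * G| ≤ |a * G'| + |b * G| := abs_add_le _ _
      _ = |a| * G' + |b| * G := by rw [abs_mul, abs_mul, abs_of_nonneg G0, abs_of_nonneg G0']
      _ ≤ (L * G) * G' + (L * G') * G := by gcongr
      _ = 2 * L * (G * G') := by ring
      _ ≤ 2 * L * (t * (pp * (F + F'))) := by gcongr
      _ = _ := by ring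
  exact le_of_mul_le_mul_left this hpos

lemma bound_zero (m : ℝ) (hm : 0 < m) {q : ℝ → ℝ} {L : ℝ} (hL : 0 ≤ L)
    (hq : ∀ x y, |q x - q y| ≤ L * |x - y|) (h0 : ∫ s in Ioi 0, q s * gW m s = 0) :
    |q 0| ≤ m * L := by
  have iW := gW_int m hm
  have iq := gW_lip_int m hm hL hq
  have is : IntegrableOn (fun s => s * gW m s) (Ioi 0) :=
    gW_lip_int m hm (q := fun s => s) (L := 1) zero_le_one (by simp)
  have nZ : 0 < ∫ s in Ioi 0, gW m s := by
    rw [setIntegral_pos_iff_support_of_nonneg_ae _ iW]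
    · have : Function.support (gW m) ∩ Ioi 0 = Ioi 0 := by
        apply inter_eq_right.mpr
        intro s hs
        exact (gW_pos m hs).ne'
      rw [this]; simp
    · exact (ae_restrict_iff' measurableSet_Ioi).mpr (Eventually.of_forall fun s hs => (gW_pos m hs).le)
  have e2 := gW_mean m hm
  have e3 : (∫ s in Ioi 0, (m - s) * gW m s) = m * (∫ s in Ioi 0, gW m s) - ∫ s in Ioi 0, s * gW m s := by
    rw [← integral_const_mul, ← integral_sub (iW.const_mul m) is]
    congr 1; ext s; ring
  have bb : |q 0 * (∫ s in Ioi 0, gW m s) - ∫ s in Ioi 0, q s * gW m s| ≤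
      L * (∫ s in Ioi 0, s * gW m s) := by
    rw [← integral_const_mul, ← integral_const_mul, ← integral_sub (iW.const_mul _) iq, ← Real.norm_eq_abs]
    refine norm_integral_le_of_norm_le (is.const_mul _) ?_
    refine (ae_restrict_iff' measurableSet_Ioi).mpr (Eventually.of_forall fun s hs => ?_)
    have hs : 0 < s := hs
    have hw := gW_pos m hs
    have h := hq 0 s
    rw [abs_sub_comm 0 s, sub_zero, abs_of_pos hs] at h
    rw [← sub_mul, norm_mul, Real.norm_of_nonneg hw.le, Real.norm_eq_abs, ← mul_assoc]
    gcongr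
  rw [h0, sub_zero, abs_mul, abs_of_pos nZ] at bb
  have : (∫ s in Ioi 0, s * gW m s) = m * ∫ s in Ioi 0, gW m s := by linarith
  rw [this] at bb
  refine le_of_mul_le_mul_right ?_ nZ
  linarith

lemma bound_neg (m : ℝ) (hm : 0 < m) {q : ℝ → ℝ} {L : ℝ} (hL : 0 ≤ L)
    (hq : ∀ x y, |q x - q y| ≤ L * |x - y|) (h0 : |q 0| ≤ m * L)
    {t : ℝ} (ht : t < 0) : |q t + (t - m) * gS (1/2) m q t| ≤ 2 * (-t) * L := by
  have hqc := lip_cont hL hq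
  have one := gS_one m hm ht.ne
  have e : q t + (t - m) * gS (1/2) m q t = ∫ r in (0:ℝ)..1, (1/2) * r ^ (m/2-1) *
      (exp (1/2 * t * (1 - r)) * ((m - t * r) * q t - (m - t) * q (t * r))) := by
    have : q t + (t - m) * gS (1/2) m q t = q t * gS (1/2) m (fun s => m - s) t + (t - m) * gS (1/2) m q t := by
      rw [one]; ring
    rw [this, gS, gS, ← intervalIntegral.integral_const_mul, ← intervalIntegral.integral_const_mul,
      ← intervalIntegral.integral_add]
    · congr 1; ext r; ring
    · exact (gS_intble m hm _ (by fun_prop) 0 1).const_mul _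
    · exact (gS_intble m hm _ (by fun_prop) 0 1).const_mul _
  have e2 : 2 * (-t) * L = ∫ r in (0:ℝ)..1, 2 * (-t) * L * ((1/2) * r ^ (m/2-1) *
      (exp (1/2 * t * (1 - r)) * (m - t * r))) := by
    rw [intervalIntegral.integral_const_mul]
    unfold gS at one
    rw [one, mul_one]
  rw [e, e2, ← Real.norm_eq_abs]
  refine intervalIntegral.norm_integral_le_of_norm_le zero_le_one ?_ ((gS_intble m hm _ (by fun_prop) 0 1).const_mul _)
  refine Eventually.of_forall fun r hr => ?_
  have hr0 := hr.1
  have hr1 := hr.2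
  have hp := rpow_nonneg hr0.le (m/2-1)
  have he := exp_pos (1/2 * t * (1 - r))
  rw [norm_mul, Real.norm_of_nonneg (by positivity), norm_mul, Real.norm_of_nonneg he.le, Real.norm_eq_abs]
  have htr : t * r ≤ 0 := by nlinarith
  have b1 := hq (t * r) 0
  rw [sub_zero, abs_of_nonpos htr] at b1
  have b2 := hq t (t * r)
  rw [show t - t * r = - ((-t) * (1 - r)) by ring, abs_neg, abs_of_nonneg (by nlinarith : 0 ≤ (-t) * (1 - r))] at b2
  have key : |(m - t * r) * q t - (m - t) * q (t * r)| ≤ 2 * (-t) * L * (m - t * r) := by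
    have h1 : (m - t * r) * q t - (m - t) * q (t * r) =
      (m - t * r) * (q t - q (t * r)) - (-t) * (1 - r) * (q (t * r) - q 0) - (-t) * (1 - r) * q 0 := by ring
    have n1 : 0 ≤ m - t * r := by linarith
    have n2 : 0 ≤ (-t) * (1 - r) := by nlinarith
    rw [h1]
    calc _ ≤ |(m - t * r) * (q t - q (t * r))| + |(-t) * (1 - r) * (q (t * r) - q 0)| + |(-t) * (1 - r) * q 0| :=
          (abs_sub _ _).trans (add_le_add_left (abs_sub _ _) _)
      _ = (m - t * r) * |q t - q (t * r)| + (-t) * (1 - r) * |q (t * r) - q 0| + (-t) * (1 - r) * |q 0| := by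
          rw [abs_mul, abs_mul, abs_mul ((-t) * (1 - r)) (q 0), abs_of_nonneg n1, abs_of_nonneg n2]
      _ ≤ (m - t * r) * (L * (-t * (1 - r))) + (-t) * (1 - r) * (L * -(t * r)) + (-t) * (1 - r) * (m * L) := by gcongr
      _ = 2 * (-t) * L * (m - t * r) * (1 - r) := by ring
      _ ≤ 2 * (-t) * L * (m - t * r) * 1 := by
          have : 0 ≤ 2 * (-t) * L * (m - t * r) := by
            have : 0 ≤ -t := by linarith
            positivity
          gcongr; linarith
      _ = _ := by ring
  calc _ ≤ 1 / 2 * r ^ (m / 2 - 1) * (exp (1 / 2 * t * (1 - r)) * (2 * (-t) * L * (m - t * r))) := by gcongr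
    _ = _ := by ring

lemma lip_of_deriv {g g' : ℝ → ℝ} {C : ℝ} (hg : Continuous g)
    (hd : ∀ t ≠ 0, HasDerivAt g (g' t) t) (hC : ∀ t ≠ 0, |g' t| ≤ C) (x y : ℝ) :
    |g x - g y| ≤ C * |x - y| := by
  have base : ∀ a b : ℝ, a < b → (∀ t ∈ Ioo a b, t ≠ 0) → |g b - g a| ≤ C * (b - a) := by
    intro a b hab h
    obtain ⟨c, hc, e⟩ := exists_hasDerivAt_eq_slope g g' hab hg.continuousOn (fun t ht => hd t (h t ht))
    have hba : 0 < b - a := by linarith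
    have : g b - g a = g' c * (b - a) := by rw [e]; field_simp
    rw [this, abs_mul, abs_of_pos hba]
    have := hC c (h c hc)
    gcongr
  have lt : ∀ a b : ℝ, a < b → |g b - g a| ≤ C * (b - a) := by
    intro a b hab
    by_cases h : a < 0 ∧ 0 < b
    · have h1 := base a 0 h.1 (fun t ht => ht.2.ne)
      have h2 := base 0 b h.2 (fun t ht => ht.1.ne')
      have := abs_add_le (g b - g 0) (g 0 - g a)
      rw [show g b - g 0 + (g 0 - g a) = g b - g a by ring] at this
      linarith
    · apply base a b hab
      rintro t ht rfl
      exact h ht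
  rcases lt_trichotomy x y with h | h | h
  · rw [abs_sub_comm, abs_sub_comm x, abs_of_pos (by linarith : 0 < y - x)]
    exact lt x y h
  · subst h; simp
  · rw [abs_of_pos (by linarith : 0 < x - y)]
    exact lt y x h

lemma gS_bound (m : ℝ) (hm : 0 < m) {q : ℝ → ℝ} {L : ℝ} (hL : 0 ≤ L)
    (hq : ∀ x y, |q x - q y| ≤ L * |x - y|) (h0 : ∫ s in Ioi 0, q s * gW m s = 0)
    {t : ℝ} (ht : t ≠ 0) : |(q t + (t - m) * gS (1/2) m q t) / (2 * t)| ≤ L := by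
  rw [abs_div, div_le_iff₀ (by positivity), abs_mul, abs_two]
  rcases lt_or_gt_of_ne ht with h | h
  · rw [abs_of_neg h]
    have := bound_neg m hm hL hq (bound_zero m hm hL hq h0) h
    linarith
  · rw [abs_of_pos h]
    have := bound_pos m hm hL hq h0 h
    linarith

lemma gS_deriv' (m : ℝ) (hm : 0 < m) (q : ℝ → ℝ) (hq : Continuous q) {t : ℝ} (ht : t ≠ 0) :
    HasDerivAt (gS (1/2) m q) ((q t + (t - m) * gS (1/2) m q t) / (2 * t)) t := by
  have := gS_deriv (1/2) m hm q hq ht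
  rwa [show 2 * (1/2) * t = t by ring] at this

lemma main_aux (m : ℝ) (hm : 0 < m) {q q' : ℝ → ℝ} {L L' : ℝ} (hL : 0 ≤ L) (hL' : 0 ≤ L')
    (hq : ∀ x y, |q x - q y| ≤ L * |x - y|) (hd : ∀ x, HasDerivAt q (q' x) x)
    (hq' : ∀ x y, |q' x - q' y| ≤ L' * |x - y|)
    (h0 : ∫ s in Ioi 0, q s * gW m s = 0) :
    ∃ f g : ℝ → ℝ, (∀ t, HasDerivAt f (g t) t) ∧ (∀ t, 2 * t * g t - (t - m) * f t = q t) ∧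
      (∀ x y, |g x - g y| ≤ (L + L') * |x - y|) := by
  have cq := lip_cont hL hq
  have cf := gS_cont (1/2) m hm q cq
  have df : ∀ t ≠ 0, HasDerivAt (gS (1/2) m q) ((q t + (t - m) * gS (1/2) m q t) / (2 * t)) t :=
    fun t ht => gS_deriv' m hm q cq ht
  have bf : ∀ t ≠ 0, |(q t + (t - m) * gS (1/2) m q t) / (2 * t)| ≤ L :=
    fun t ht => gS_bound m hm hL hq h0 ht
  have lf := lip_of_deriv cf df bf
  generalize gS (1/2) m q = f at *
  have cq2 : Continuous (fun t => q' t + f t) := (lip_cont hL' hq').add cf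
  have lq2 : ∀ x y, |(fun t => q' t + f t) x - (fun t => q' t + f t) y| ≤ (L + L') * |x - y| := by
    intro x y
    have h1 := lf x y
    have h2 := hq' x y
    have := abs_add_le (q' x - q' y) (f x - f y)
    simp only
    rw [show q' x + f x - (q' y + f y) = q' x - q' y + (f x - f y) by ring]
    linarith
  have dg0 : ∀ t ≠ 0, HasDerivAt (fun t => (q t + (t - m) * f t) / (2 * t))
      (((fun t => q' t + f t) t + (t - (m+2)) * ((fun t => (q t + (t - m) * f t) / (2 * t)) t)) / (2 * t)) t := by
    intro t ht
    have d := (((hd t).add (((hasDerivAt_id t).sub_const m).mul (df t ht))).div ((hasDerivAt_id t).const_mul 2)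
      (by simpa using ht))
    refine d.congr_deriv ?_
    simp
    field_simp
    ring
  have hu : ∀ t ≠ 0, (q t + (t - m) * f t) / (2 * t) = gS (1/2) (m+2) (fun t => q' t + f t) t :=
    fun t ht => gS_unique (m+2) (by linarith) _ cq2 (fun t => (q t + (t - m) * f t) / (2 * t)) L bf dg0 ht
  have cg := gS_cont (1/2) (m+2) (by linarith) _ cq2
  have dg : ∀ t ≠ 0, HasDerivAt (gS (1/2) (m+2) (fun t => q' t + f t)) _ t :=
    fun t ht => gS_deriv' (m+2) (by linarith) _ cq2 ht
  have fall : ∀ t, HasDerivAt f (gS (1/2) (m+2) (fun t => q' t + f t) t) t := by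
    intro t
    refine hasDerivAt_of_hasDerivAt_of_ne' (x := 0) ?_ cf.continuousAt cg.continuousAt t
    intro y hy
    rw [← hu y hy]
    exact df y hy
  have bg : ∀ t, |gS (1/2) (m+2) (fun t => q' t + f t) t| ≤ L + |gS (1/2) (m+2) (fun t => q' t + f t) 0| := by
    intro t
    rcases eq_or_ne t 0 with h | h
    · rw [h]; linarith
    · rw [← hu t h]
      have := bf t h
      have := abs_nonneg (gS (1/2) (m+2) (fun t => q' t + f t) 0)
      linarith
  have mz := gW_mean_zero (m+2) (by linarith) (q := fun t => q' t + f t) (by linarith : 0 ≤ L + L') lq2 bg dg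
  refine ⟨f, gS (1/2) (m+2) (fun t => q' t + f t), fall, ?_, ?_⟩
  · have e : (fun t => 2 * t * gS (1/2) (m+2) (fun t => q' t + f t) t - (t - m) * f t) = q := by
      refine Continuous.ext_on (s := {0}ᶜ) (dense_compl_singleton 0) (by fun_prop) cq ?_
      intro t ht
      have ht : t ≠ 0 := ht
      simp only
      rw [← hu t ht]
      field_simp
      ring
    exact fun t => congrFun e t
  · exact lip_of_deriv cg dg
      (fun t ht => gS_bound (m+2) (by linarith) (by linarith) lq2 mz ht)

lemma lipConst_spec {h : ℝ → ℝ} (hh : ∃ K : NNReal, LipschitzWith K h) :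
    0 ≤ lipConst h ∧ ∀ x y, |h x - h y| ≤ lipConst h * |x - y| := by
  obtain ⟨K, hK⟩ := hh
  constructor
  · apply Real.sSup_nonneg
    rintro c ⟨x, y, _, rfl⟩
    positivity
  · intro x y
    rcases eq_or_ne x y with e | e
    · simp [e]
    · have hp : 0 < |x - y| := abs_pos.mpr (sub_ne_zero.mpr e)
      rw [← div_le_iff₀ hp]
      refine le_csSup ⟨K, ?_⟩ ⟨x, y, e, rfl⟩
      rintro c ⟨x, y, e, rfl⟩
      have hp : 0 < |x - y| := abs_pos.mpr (sub_ne_zero.mpr e)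
      rw [div_le_iff₀ hp, ← Real.dist_eq, ← Real.dist_eq]
      exact hK.dist_le_mul x y

lemma exp_centered (ν : ℝ) (hν : 0 < ν) {h : ℝ → ℝ} {L : ℝ} (hL : 0 ≤ L)
    (hh : ∀ x y, |h x - h y| ≤ L * |x - y|) :
    ∫ s in Ioi 0, (h (s - ν) - centeredGammaExp ν h) * gW ν s = 0 := by
  have a0 : 0 < ν / 2 := by positivity
  have hG := Gamma_pos_of_pos a0
  have gen : ∀ k : ℝ → ℝ, (∫ x, k (2 * x) ∂(gammaMeasure (ν / 2) 1)) =
      (1 / Gamma (ν/2)) * (2 ^ (ν/2))⁻¹ * ∫ s in Ioi 0, k s * gW ν s := by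
    intro k
    rw [gammaMeasure, integral_withDensity_eq_integral_toReal_smul (f := gammaPDF (ν/2) 1)
      (by unfold gammaPDF; fun_prop) (Eventually.of_forall fun x => ENNReal.ofReal_lt_top)]
    have e1 : (fun x => (gammaPDF (ν/2) 1 x).toReal • k (2 * x)) =
        (Ici 0).indicator (fun x => (1 / Gamma (ν/2)) * (2 ^ (ν/2-1))⁻¹ * (k (2 * x) * gW ν (2 * x))) := by
      ext x
      rw [gammaPDF, ENNReal.toReal_ofReal (gammaPDFReal_nonneg a0 one_pos x)]
      by_cases hx : 0 ≤ x
      · rw [indicator_of_mem (show x ∈ Ici 0 from hx), gammaPDFReal, if_pos hx, gW, mul_rpow zero_le_two hx,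
          show -(1/2) * (2 * x) = -(1 * x) by ring]
        have : (2:ℝ) ^ (ν/2-1) ≠ 0 := by positivity
        simp only [one_rpow, smul_eq_mul]
        field_simp
      · rw [indicator_of_notMem (show x ∉ Ici 0 from hx), gammaPDFReal, if_neg hx, zero_smul]
    rw [e1, integral_indicator measurableSet_Ici, integral_Ici_eq_integral_Ioi, integral_const_mul,
      integral_comp_mul_left_Ioi (fun s => k s * gW ν s) 0 two_pos, mul_zero, smul_eq_mul, rpow_sub_one two_ne_zero]
    field_simp
  have hl : ∀ x y, |(fun s => h (s - ν)) x - (fun s => h (s - ν)) y| ≤ L * |x - y| := by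
    intro x y
    have := hh (x - ν) (y - ν)
    rwa [show x - ν - (y - ν) = x - y by ring] at this
  have iq := gW_lip_int ν hν hL hl
  have iW := gW_int ν hν
  have E1 : centeredGammaExp ν h = _ := gen (fun s => h (s - ν))
  have E2 := gen (fun _ => 1)
  have := isProbabilityMeasure_gammaMeasure a0 one_pos
  simp only [one_mul, integral_const, probReal_univ, smul_eq_mul] at E2
  have : ∫ s in Ioi 0, (h (s - ν) - centeredGammaExp ν h) * gW ν s =
      (∫ s in Ioi 0, h (s - ν) * gW ν s) - centeredGammaExp ν h * ∫ s in Ioi 0, gW ν s := by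
    rw [← integral_const_mul, ← integral_sub iq (iW.const_mul _)]
    congr 1; ext s; ring
  rw [this, E1]
  linear_combination (∫ s in Ioi 0, h (s - ν) * gW ν s) * E2

/-- Theorem `bounds2`(b): for `ν > 0` and `h : ℝ → ℝ` continuously
differentiable with `h` and `h'` Lipschitz, there exists a continuously differentiable solution
`f` on `ℝ` of the centered Gamma Stein equation `2(x+ν) f'(x) − x f(x) = h(x) − E[h(Z_ν)]`
whose derivative is Lipschitz with `‖f''‖ ≤ max(1, 2/ν) ‖h'‖ + ‖h''‖`. -/
theorem centered_gamma_stein_solution_C1_second_bound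
    (ν : ℝ) (hν : 0 < ν)
    (h : ℝ → ℝ) (hC1 : ContDiff ℝ 1 h)
    (hLip : ∃ K : NNReal, LipschitzWith K h)
    (hLip' : ∃ K : NNReal, LipschitzWith K (deriv h)) :
    ∃ f : ℝ → ℝ,
      ContDiff ℝ 1 f ∧
      (∀ x : ℝ, 2 * (x + ν) * deriv f x - x * f x = h x - centeredGammaExp ν h) ∧
      LipschitzWith (Real.toNNReal (max 1 (2 / ν) * lipConst h + lipConst (deriv h)))
        (deriv f) := by

  obtain ⟨hL, hh⟩ := lipConst_spec hLip
  obtain ⟨hL', hh'⟩ := lipConst_spec hLip'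
  have sh : ∀ k : ℝ → ℝ, ∀ K, (∀ x y, |k x - k y| ≤ K * |x - y|) → ∀ x y, |k (x - ν) - k (y - ν)| ≤ K * |x - y| := by
    intro k K hk x y
    have := hk (x - ν) (y - ν)
    rwa [show x - ν - (y - ν) = x - y by ring] at this
  obtain ⟨f, g, hf, he, hg⟩ := main_aux ν hν (q := fun s => h (s - ν) - centeredGammaExp ν h)
    (q' := fun s => deriv h (s - ν)) hL hL'
    (by intro x y; simpa using sh h _ hh x y)
    (by
      intro x
      have := (hC1.differentiable one_ne_zero (x - ν)).hasDerivAt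
      exact (this.comp_sub_const x ν).sub_const _)
    (sh (deriv h) _ hh') (exp_centered ν hν hL hh)
  have hf' : ∀ x, HasDerivAt (fun x => f (x + ν)) (g (x + ν)) x := fun x => (hf (x + ν)).comp_add_const x ν
  have hd : deriv (fun x => f (x + ν)) = fun x => g (x + ν) := funext fun x => (hf' x).deriv
  have hgc : Continuous g := lip_cont (by linarith) hg
  refine ⟨fun x => f (x + ν), ?_, ?_, ?_⟩
  · rw [contDiff_one_iff_deriv, hd]
    exact ⟨fun x => (hf' x).differentiableAt, by fun_prop⟩
  · intro x
    have := he (x + ν)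
    rw [hd]
    simp only [add_sub_cancel_right] at this ⊢
    exact this
  · rw [hd]
    have hle : lipConst h + lipConst (deriv h) ≤ max 1 (2 / ν) * lipConst h + lipConst (deriv h) := by
      have := le_max_left 1 (2 / ν)
      nlinarith
    apply LipschitzWith.of_dist_le_mul
    intro x y
    rw [Real.coe_toNNReal _ (by linarith), Real.dist_eq, Real.dist_eq]
    have := hg (x + ν) (y + ν)
    rw [show x + ν - (y + ν) = x - y by ring] at this
    exact this.trans (mul_le_mul_of_nonneg_right hle (abs_nonneg _))
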